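/- arXiv:1701.05000 — 2 statements merged into one kernel-verified Lean document; each statement's English description precedes it below -/
import Mathlib

section
/- Let (X,d) be a metric space, let f : X → ℝ be Lipschitz, and let γ : [0,1] → X be a geodesic that represents the gradient of f at time 0. Then lip f(γ_0) = |γ̇| and lim_{t↓0} (f(γ_t) − f(γ_0))/t = |γ̇|². -/
open Filter Topology Metric Set

open scoped Classical in
/-- The local Lipschitz constant (slope) of `f` at `x`:
`limsup_{y → x} |f y − f x| / dist y x` if `x` is not isolated, `0` otherwise. -/
noncomputable def locLip {X : Type*} [MetricSpace X] (f : X → ℝ) (x : X) : ℝ :=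
  if (𝓝[≠] x).NeBot then
    Filter.limsup (fun y => |f y - f x| / dist y x) (𝓝[≠] x)
  else 0

/-- A constant-speed geodesic parametrized on `[0,1]`:
`dist (γ s) (γ t) = |s − t| * dist (γ 0) (γ 1)` for all `s, t ∈ [0,1]`. -/
def IsGeodesic {X : Type*} [MetricSpace X] (γ : ℝ → X) : Prop :=
  ∀ s ∈ Set.Icc (0:ℝ) 1, ∀ t ∈ Set.Icc (0:ℝ) 1,
    dist (γ s) (γ t) = |s - t| * dist (γ 0) (γ 1)

/-- `γ` represents the gradient of `f` at time 0:
`liminf_{t↓0} (f(γ t) − f(γ 0))/t ≥ ½ lip f(γ 0)² + ½ |γ̇|²`,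
where `|γ̇| = dist (γ 0) (γ 1)` is the speed of the geodesic. -/
noncomputable def RepresentsGradAtZero {X : Type*} [MetricSpace X]
    (f : X → ℝ) (γ : ℝ → X) : Prop :=
  (1/2) * locLip f (γ 0) ^ 2 + (1/2) * dist (γ 0) (γ 1) ^ 2 ≤
    Filter.liminf (fun t : ℝ => (f (γ t) - f (γ 0)) / t) (𝓝[>] (0:ℝ))

/-- Any constant above the local Lipschitz constant eventually bounds the difference quotients. -/
theorem LipschitzWith.eventually_div_dist_lt {X : Type*} [MetricSpace X] {f : X → ℝ} {K : NNReal}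
    (hf : LipschitzWith K f) {x : X} {c : ℝ} (hc : locLip f x < c) :
    ∀ᶠ y in 𝓝[≠] x, |f y - f x| / dist y x < c := by
  rcases (𝓝[≠] x).eq_or_neBot with h | h
  · simp [h]
  · rw [locLip, if_pos h] at hc
    refine eventually_lt_of_limsup_lt hc (isBoundedUnder_of ⟨K, fun y => ?_⟩)
    exact div_le_of_le_mul₀ dist_nonneg K.coe_nonneg (by simpa [Real.dist_eq] using hf.dist_le_mul y x)

theorem IsGeodesic.dist_zero_left {X : Type*} [MetricSpace X] {γ : ℝ → X} (hγ : IsGeodesic γ) {t : ℝ}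
    (ht : t ∈ Set.Ioo (0 : ℝ) 1) : dist (γ t) (γ 0) = t * dist (γ 0) (γ 1) := by
  simpa [abs_of_pos ht.1] using hγ t ⟨ht.1.le, ht.2.le⟩ 0 (by simp)

/-- A nonconstant geodesic approaches its starting point through other points. -/
theorem IsGeodesic.tendsto_nhdsNE {X : Type*} [MetricSpace X] {γ : ℝ → X} (hγ : IsGeodesic γ)
    (hD : 0 < dist (γ 0) (γ 1)) : Tendsto γ (𝓝[>] (0 : ℝ)) (𝓝[≠] (γ 0)) := by
  have hI : ∀ᶠ t in 𝓝[>] (0 : ℝ), t ∈ Set.Ioo (0 : ℝ) 1 := Ioo_mem_nhdsGT one_pos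
  refine tendsto_nhdsWithin_iff.2 ⟨tendsto_iff_dist_tendsto_zero.2 ?_, ?_⟩
  · have h : Tendsto (fun t : ℝ => t * dist (γ 0) (γ 1)) (𝓝[>] (0 : ℝ)) (𝓝 0) :=
      (Continuous.tendsto' (by fun_prop) _ _ (by simp)).mono_left nhdsWithin_le_nhds
    exact h.congr' (hI.mono fun t ht => (hγ.dist_zero_left ht).symm)
  · filter_upwards [hI] with t ht
    exact dist_pos.1 (hγ.dist_zero_left ht ▸ mul_pos ht.1 hD)

/-- if the geodesic `γ` represents the gradient of `f` at time 0,
then `lip f(γ 0) = |γ̇|` and `lim_{t↓0} (f(γ t) − f(γ 0))/t = |γ̇|²`. -/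
theorem stmt5 {X : Type*} [MetricSpace X] (f : X → ℝ) (K : NNReal)
    (hf : LipschitzWith K f) (γ : ℝ → X) (hγ : IsGeodesic γ)
    (hrep : RepresentsGradAtZero f γ) :
    locLip f (γ 0) = dist (γ 0) (γ 1) ∧
    Filter.Tendsto (fun t : ℝ => (f (γ t) - f (γ 0)) / t) (𝓝[>] (0:ℝ))
      (𝓝 (dist (γ 0) (γ 1) ^ 2)) := by
  have hI : ∀ᶠ t in 𝓝[>] (0 : ℝ), t ∈ Set.Ioo (0 : ℝ) 1 := Ioo_mem_nhdsGT one_pos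
  unfold RepresentsGradAtZero at hrep
  rcases (dist_nonneg (x := γ 0) (y := γ 1)).eq_or_lt' with hD | hD
  · have hlim : Tendsto (fun t : ℝ => (f (γ t) - f (γ 0)) / t) (𝓝[>] (0 : ℝ)) (𝓝 0) := by
      refine tendsto_const_nhds.congr' (hI.mono fun t ht => ?_)
      have h : γ t = γ 0 := dist_eq_zero.1 (by rw [hγ.dist_zero_left ht, hD, mul_zero])
      simp [h]
    rw [hlim.liminf_eq, hD] at hrep
    rw [hD]
    refine ⟨pow_eq_zero_iff two_ne_zero |>.1 (le_antisymm (by linarith) (sq_nonneg _)), ?_⟩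
    simpa using hlim
  · have hupper : ∀ a, locLip f (γ 0) * dist (γ 0) (γ 1) < a →
        ∀ᶠ t in 𝓝[>] (0 : ℝ), (f (γ t) - f (γ 0)) / t < a := by
      intro a ha
      filter_upwards [hI, (hγ.tendsto_nhdsNE hD).eventually
        (hf.eventually_div_dist_lt ((lt_div_iff₀ hD).2 ha))] with t ht h
      rw [hγ.dist_zero_left ht, div_lt_div_iff₀ (mul_pos ht.1 hD) hD, ← mul_assoc] at h
      rw [div_lt_iff₀ ht.1]
      exact (le_abs_self _).trans_lt (lt_of_mul_lt_mul_right h hD.le)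
    have hbelow : IsBoundedUnder (· ≥ ·) (𝓝[>] (0 : ℝ))
        (fun t : ℝ => (f (γ t) - f (γ 0)) / t) := by
      refine isBoundedUnder_of_eventually_ge (a := -(K * dist (γ 0) (γ 1))) (hI.mono fun t ht => ?_)
      have h := hf.dist_le_mul (γ t) (γ 0)
      rw [hγ.dist_zero_left ht, Real.dist_eq] at h
      rw [le_div_iff₀ ht.1]
      linarith [neg_abs_le (f (γ t) - f (γ 0))]
    have hle : liminf (fun t : ℝ => (f (γ t) - f (γ 0)) / t) (𝓝[>] (0 : ℝ)) ≤
        locLip f (γ 0) * dist (γ 0) (γ 1) :=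
      le_of_forall_gt_imp_ge_of_dense fun a ha =>
        liminf_le_of_frequently_le ((hupper a ha).mono fun _ h => h.le).frequently hbelow
    have heq : locLip f (γ 0) = dist (γ 0) (γ 1) := by
      refine sub_eq_zero.1 (pow_eq_zero_iff two_ne_zero |>.1 (le_antisymm ?_ (sq_nonneg _)))
      linarith [hrep.trans hle]
    rw [heq] at hrep hupper
    refine ⟨heq, tendsto_order.2 ⟨fun a ha => ?_, fun a ha => hupper a (by rwa [← sq])⟩⟩
    exact eventually_lt_of_lt_liminf (ha.trans_le (by linarith)) hbelow
end

section
/- Let (X,d) be a metric space, let f, g : X → ℝ be Lipschitz, and let γ : [0,1] → X be a geodesic that represents the gradient of f at time 0. If the two-sided limit F := lim_{ε→0} (lip(f + εg)²(γ_0) − lip f²(γ_0))/(2ε) exists, then the limit lim_{t↓0} (g(γ_t) − g(γ_0))/t exists and equals F. -/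
open Filter Topology Metric Set

theorem isBoundedUnder_abs_sub_div_dist {X : Type*} [MetricSpace X] {h : X → ℝ} {x : X} {C : ℝ}
    (hC : ∀ y, |h y - h x| ≤ C * dist y x) :
    IsBoundedUnder (· ≤ ·) (𝓝[≠] x) (fun y => |h y - h x| / dist y x) := by
  refine isBoundedUnder_of_eventually_le (a := C) ?_
  filter_upwards [self_mem_nhdsWithin] with y hy
  exact (div_le_iff₀ (dist_pos.2 hy)).2 (hC y)

theorem locLip_nonneg {X : Type*} [MetricSpace X] {h : X → ℝ} {x : X} {C : ℝ}
    (hC : ∀ y, |h y - h x| ≤ C * dist y x) : 0 ≤ locLip h x := by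
  unfold locLip
  split_ifs with hx
  · exact le_limsup_of_frequently_le
      (Eventually.frequently (Eventually.of_forall fun y => by positivity))
      (isBoundedUnder_abs_sub_div_dist hC)
  · exact le_rfl

theorem eventually_abs_sub_lt_locLip_add {X : Type*} [MetricSpace X] {h : X → ℝ} {x : X} {C : ℝ}
    (hC : ∀ y, |h y - h x| ≤ C * dist y x) {δ : ℝ} (hδ : 0 < δ) :
    ∀ᶠ y in 𝓝[≠] x, |h y - h x| / dist y x < locLip h x + δ := by
  by_cases hx : (𝓝[≠] x).NeBot
  · refine eventually_lt_of_limsup_lt ?_ (isBoundedUnder_abs_sub_div_dist hC)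
    rw [locLip, if_pos hx]
    linarith
  · rw [not_neBot] at hx
    simp [hx]

theorem IsGeodesic.dist_zero {X : Type*} [MetricSpace X] {γ : ℝ → X} (hγ : IsGeodesic γ) {t : ℝ}
    (ht : 0 < t) (ht1 : t < 1) : dist (γ t) (γ 0) = t * dist (γ 0) (γ 1) := by
  rw [hγ t ⟨ht.le, ht1.le⟩ 0 (by simp), sub_zero, abs_of_pos ht]

theorem eventually_mem_Ioo_zero_one : ∀ᶠ t : ℝ in 𝓝[>] 0, t ∈ Ioo (0 : ℝ) 1 :=
  Ioo_mem_nhdsGT one_pos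

/-- Along a geodesic, difference quotients are bounded by `½ lip² + ½ |γ̇|²` in the limit. -/
theorem IsGeodesic.eventually_quotient_lt {X : Type*} [MetricSpace X] {γ : ℝ → X}
    (hγ : IsGeodesic γ) {h : X → ℝ} {C : ℝ}
    (hC : ∀ y, |h y - h (γ 0)| ≤ C * dist y (γ 0)) {δ : ℝ} (hδ : 0 < δ) :
    ∀ᶠ t in 𝓝[>] (0 : ℝ), (h (γ t) - h (γ 0)) / t <
      (1 / 2) * locLip h (γ 0) ^ 2 + (1 / 2) * dist (γ 0) (γ 1) ^ 2 + δ := by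
  set D := dist (γ 0) (γ 1) with hD
  have hL := locLip_nonneg hC
  rcases (dist_nonneg : 0 ≤ D).eq_or_lt with h0 | h0
  · filter_upwards [eventually_mem_Ioo_zero_one] with t ht
    have hdist := hγ.dist_zero ht.1 ht.2
    rw [← hD, show D = 0 from h0.symm, mul_zero, dist_eq_zero] at hdist
    rw [hdist, sub_self, zero_div]
    positivity
  · have htend : Tendsto γ (𝓝[>] 0) (𝓝[≠] (γ 0)) := by
      refine tendsto_nhdsWithin_iff.2 ⟨?_, ?_⟩
      · rw [tendsto_iff_dist_tendsto_zero]
        have hlin : Tendsto (fun t : ℝ => t * D) (𝓝[>] 0) (𝓝 0) := by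
          have hc : Continuous fun t : ℝ => t * D := by fun_prop
          simpa using (hc.tendsto 0).mono_left nhdsWithin_le_nhds
        refine hlin.congr' ?_
        filter_upwards [eventually_mem_Ioo_zero_one] with t ht
        exact (hγ.dist_zero ht.1 ht.2).symm
      · filter_upwards [eventually_mem_Ioo_zero_one] with t ht
        refine dist_pos.1 ?_
        rw [hγ.dist_zero ht.1 ht.2]
        exact mul_pos ht.1 h0
    filter_upwards [htend.eventually (eventually_abs_sub_lt_locLip_add hC (div_pos hδ h0)),
      eventually_mem_Ioo_zero_one] with t hlt ht
    rw [hγ.dist_zero ht.1 ht.2, ← hD, div_lt_iff₀ (mul_pos ht.1 h0)] at hlt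
    have hle : (h (γ t) - h (γ 0)) / t < (locLip h (γ 0) + δ / D) * D := by
      rw [div_lt_iff₀ ht.1]
      calc h (γ t) - h (γ 0) ≤ |h (γ t) - h (γ 0)| := le_abs_self _
        _ < _ := hlt
        _ = _ := by ring
    rw [add_mul, div_mul_cancel₀ _ h0.ne'] at hle
    nlinarith [sq_nonneg (locLip h (γ 0) - D)]

theorem RepresentsGradAtZero.eventually_lt_quotient {X : Type*} [MetricSpace X] {f : X → ℝ}
    {γ : ℝ → X} (hrep : RepresentsGradAtZero f γ) (hγ : IsGeodesic γ) {C : ℝ}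
    (hC : ∀ y, |f y - f (γ 0)| ≤ C * dist y (γ 0)) {δ : ℝ} (hδ : 0 < δ) :
    ∀ᶠ t in 𝓝[>] (0 : ℝ), (1 / 2) * locLip f (γ 0) ^ 2 + (1 / 2) * dist (γ 0) (γ 1) ^ 2 - δ <
      (f (γ t) - f (γ 0)) / t := by
  refine eventually_lt_of_lt_liminf (lt_of_lt_of_le (sub_lt_self _ hδ) hrep) ?_
  refine isBoundedUnder_of_eventually_ge (a := -(C * dist (γ 0) (γ 1))) ?_
  filter_upwards [eventually_mem_Ioo_zero_one] with t ht
  have hbound := hC (γ t)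
  rw [hγ.dist_zero ht.1 ht.2] at hbound
  rw [le_div_iff₀ ht.1]
  linarith [neg_abs_le (f (γ t) - f (γ 0))]

/-- if `γ` represents the gradient of `f` at time 0 and the two-sided
limit `F = lim_{ε→0} (lip(f+εg)²(γ 0) − lip f²(γ 0))/(2ε)` exists, then
`lim_{t↓0} (g(γ t) − g(γ 0))/t` exists and equals `F`. -/
theorem stmt7 {X : Type*} [MetricSpace X] (f g : X → ℝ) (Kf Kg : NNReal)
    (hf : LipschitzWith Kf f) (hg : LipschitzWith Kg g)
    (γ : ℝ → X) (hγ : IsGeodesic γ) (hrep : RepresentsGradAtZero f γ)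
    (F : ℝ)
    (hF : Filter.Tendsto
      (fun ε : ℝ =>
        (locLip (fun y => f y + ε * g y) (γ 0) ^ 2 - locLip f (γ 0) ^ 2)
          / (2 * ε))
      (𝓝[≠] (0:ℝ)) (𝓝 F)) :
    Filter.Tendsto (fun t : ℝ => (g (γ t) - g (γ 0)) / t) (𝓝[>] (0:ℝ)) (𝓝 F) := by
  have hCf : ∀ y, |f y - f (γ 0)| ≤ Kf * dist y (γ 0) := fun y => by
    simpa [Real.dist_eq] using hf.dist_le_mul y (γ 0)
  have hCg : ∀ y, |g y - g (γ 0)| ≤ Kg * dist y (γ 0) := fun y => by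
    simpa [Real.dist_eq] using hg.dist_le_mul y (γ 0)
  have key : ∀ ε δ : ℝ, 0 < δ → ∀ᶠ t in 𝓝[>] (0 : ℝ), ε * ((g (γ t) - g (γ 0)) / t) <
      (locLip (fun y => f y + ε * g y) (γ 0) ^ 2 - locLip f (γ 0) ^ 2) / 2 + δ := by
    intro ε δ hδ
    have hC : ∀ y, |(fun y => f y + ε * g y) y - (fun y => f y + ε * g y) (γ 0)| ≤
        (Kf + |ε| * Kg) * dist y (γ 0) := fun y => by
      calc |f y + ε * g y - (f (γ 0) + ε * g (γ 0))|
          = |(f y - f (γ 0)) + ε * (g y - g (γ 0))| := by ring_nf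
        _ ≤ |f y - f (γ 0)| + |ε * (g y - g (γ 0))| := abs_add_le _ _
        _ ≤ Kf * dist y (γ 0) + |ε| * (Kg * dist y (γ 0)) := by
          rw [abs_mul]
          gcongr
          exacts [hCf y, hCg y]
        _ = _ := by ring
    filter_upwards [hγ.eventually_quotient_lt hC (half_pos hδ),
      hrep.eventually_lt_quotient hγ hCf (half_pos hδ)] with t h1 h2
    have hsplit : (f (γ t) + ε * g (γ t) - (f (γ 0) + ε * g (γ 0))) / t =
        (f (γ t) - f (γ 0)) / t + ε * ((g (γ t) - g (γ 0)) / t) := by ring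
    rw [hsplit] at h1
    linarith
  refine tendsto_order.2 ⟨fun a ha => ?_, fun b hb => ?_⟩
  · have hleft : Tendsto _ (𝓝[<] (0 : ℝ)) _ :=
      hF.mono_left (nhdsWithin_mono 0 fun ε (hε : ε < 0) => hε.ne)
    obtain ⟨ε, hQ, hε : ε < 0⟩ :=
      ((hleft.eventually (lt_mem_nhds ha)).and self_mem_nhdsWithin).exists
    rw [lt_div_iff_of_neg (by linarith)] at hQ
    filter_upwards [key ε _ (half_pos (sub_pos.2 hQ))] with t ht
    exact (mul_lt_mul_left_of_neg hε).1 (by linarith)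
  · have hright : Tendsto _ (𝓝[>] (0 : ℝ)) _ :=
      hF.mono_left (nhdsWithin_mono 0 fun ε (hε : 0 < ε) => hε.ne')
    obtain ⟨ε, hQ, hε : 0 < ε⟩ :=
      ((hright.eventually (gt_mem_nhds hb)).and self_mem_nhdsWithin).exists
    rw [div_lt_iff₀ (by linarith)] at hQ
    filter_upwards [key ε _ (half_pos (sub_pos.2 hQ))] with t ht
    exact (mul_lt_mul_iff_right₀ hε).1 (by linarith)
end
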